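/- arXiv:2206.02068 — 2 statements merged into one kernel-verified Lean document; each statement's English description precedes it below -/
import Mathlib

section
/- Let P be a nonempty countable family of probability distributions on ℕ, each with all components positive. Then BS(P) = ⋂_{p ∈ P} BS(p) has empty interior in S with respect to the topology on S induced by the ℓ¹-norm. -/
/-- The set of probability distributions on `ℕ`, as a subset of the Banach space `ℓ¹`. -/
def S : Set (lp (fun _ : ℕ => ℝ) 1) :=
  {q | (∀ i, 0 ≤ q i) ∧ HasSum (fun i => q i) 1}

/-- The Bayes blind spot of `p`, as a subset of `S` (with its ℓ¹-subspace topology). -/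
def BS (p : ℕ → ℝ) : Set S := {q | Function.Injective fun i => q.1 i / p i}

/-- The sequence `q` with its mass at `n + 1` and `n + 2` moved to `0`. -/
noncomputable def moveMassToZero (q : lp (fun _ : ℕ => ℝ) 1) (n : ℕ) : lp (fun _ : ℕ => ℝ) 1 :=
  q - lp.single 1 (n + 1) (q (n + 1)) - lp.single 1 (n + 2) (q (n + 2))
    + lp.single 1 0 (q (n + 1) + q (n + 2))

theorem moveMassToZero_apply (q : lp (fun _ : ℕ => ℝ) 1) (n i : ℕ) :
    moveMassToZero q n i = q i - (Pi.single (n + 1) (q (n + 1)) : ℕ → ℝ) i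
      - (Pi.single (n + 2) (q (n + 2)) : ℕ → ℝ) i
      + (Pi.single 0 (q (n + 1) + q (n + 2)) : ℕ → ℝ) i := by
  simp [moveMassToZero, Pi.single_add]

theorem moveMassToZero_mem_S {q : lp (fun _ : ℕ => ℝ) 1} (hq : q ∈ S) (n : ℕ) :
    moveMassToZero q n ∈ S := by
  refine ⟨fun i => ?_, ?_⟩
  · have h₀ := hq.1 i
    have h₁ := hq.1 (n + 1)
    have h₂ := hq.1 (n + 2)
    rw [moveMassToZero_apply]
    simp only [Pi.single_apply]
    split_ifs <;> subst_vars <;> first | omega | linarith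
  · simp only [moveMassToZero_apply]
    have h := ((hq.2.sub (hasSum_pi_single (n + 1) (q (n + 1)))).sub
      (hasSum_pi_single (n + 2) (q (n + 2)))).add
      (hasSum_pi_single 0 (q (n + 1) + q (n + 2)))
    rwa [show 1 - q (n + 1) - q (n + 2) + (q (n + 1) + q (n + 2)) = 1 by ring] at h

theorem tendsto_moveMassToZero {q : lp (fun _ : ℕ => ℝ) 1} (hq : q ∈ S) :
    Filter.Tendsto (moveMassToZero q) Filter.atTop (nhds q) := by
  have hzero : Filter.Tendsto (fun n => q n) Filter.atTop (nhds 0) :=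
    hq.2.summable.tendsto_atTop_zero
  have h₁ := (Filter.tendsto_add_atTop_iff_nat 1).2 hzero
  have h₂ := (Filter.tendsto_add_atTop_iff_nat 2).2 hzero
  have single_tendsto {k : ℕ → ℕ} {a : ℕ → ℝ} (ha : Filter.Tendsto a Filter.atTop (nhds 0)) :
      Filter.Tendsto (fun n => (lp.single 1 (k n) (a n) : lp (fun _ : ℕ => ℝ) 1))
        Filter.atTop (nhds 0) := by
    rw [tendsto_zero_iff_norm_tendsto_zero]
    simpa [lp.norm_single] using ha.norm
  have h := ((tendsto_const_nhds (x := q)).sub (single_tendsto (k := fun n => n + 1) h₁)).sub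
    (single_tendsto (k := fun n => n + 2) h₂)
  have h' := h.add (single_tendsto (k := fun _ => 0) (by simpa using h₁.add h₂))
  rwa [sub_zero, sub_zero, add_zero] at h'

theorem moveMassToZero_notMem_BS (p : ℕ → ℝ) {q : lp (fun _ : ℕ => ℝ) 1} (hq : q ∈ S) (n : ℕ) :
    (⟨moveMassToZero q n, moveMassToZero_mem_S hq n⟩ : S) ∉ BS p := by
  intro h
  have : n + 1 = n + 2 := h (by simp [moveMassToZero_apply])
  omega

theorem interior_BS_eq_empty (p : ℕ → ℝ) : interior (BS p) = ∅ := by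
  refine Set.eq_empty_of_forall_notMem fun q hq => ?_
  have hlim : Filter.Tendsto
      (fun n => (⟨moveMassToZero q.1 n, moveMassToZero_mem_S q.2 n⟩ : S))
      Filter.atTop (nhds q) :=
    tendsto_subtype_rng.2 (tendsto_moveMassToZero q.2)
  obtain ⟨n, hn⟩ := (hlim.eventually (mem_interior_iff_mem_nhds.1 hq)).exists
  exact moveMassToZero_notMem_BS p q.2 n hn

/-- For a nonempty countable family `P` of probability distributions
on `ℕ`, each with all components positive, `BS(P) = ⋂_{p ∈ P} BS(p)` has empty interior in `S`
for the ℓ¹-subspace topology. -/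
theorem bayes_blind_spot_inter_stmt13 (P : Set (ℕ → ℝ))
    (hPne : P.Nonempty) (hPcount : P.Countable)
    (hPpos : ∀ p ∈ P, ∀ i, 0 < p i) (hPsum : ∀ p ∈ P, HasSum p 1) :
    interior (⋂ p ∈ P, BS p) = ∅ := by
  obtain ⟨p, hp⟩ := hPne
  exact Set.subset_eq_empty (interior_mono (Set.biInter_subset_of_mem hp))
    (interior_BS_eq_empty p)
end

section
/- There exists a probability measure M on S (equipped with the Borel σ-algebra of the ℓ¹-subspace topology) such that for every nonempty countable family P of probability distributions on ℕ, each with all components positive, the set BS(P) = ⋂_{p ∈ P} BS(p) has M-measure 1. -/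
open MeasureTheory

theorem hasSum_one_sub_mul_pow {r : ℝ} (h₀ : 0 ≤ r) (h₁ : r < 1) :
    HasSum (fun i : ℕ => (1 - r) * r ^ i) 1 := by
  have h := (hasSum_geometric_of_lt_one h₀ h₁).mul_left (1 - r)
  rwa [mul_inv_cancel₀ (by linarith)] at h

/-- The geometric distribution with ratio `t / 2`, as an element of `ℓ¹`. -/
noncomputable def geometricLp (t : unitInterval) : lp (fun _ : ℕ => ℝ) 1 :=
  ⟨fun i => (1 - (t : ℝ) / 2) * ((t : ℝ) / 2) ^ i, by
    have h₀ := t.2.1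
    have h₁ := t.2.2
    refine memℓp_gen ?_
    have h := hasSum_one_sub_mul_pow (r := (t : ℝ) / 2) (by linarith) (by linarith)
    simpa using h.summable.norm⟩

theorem geometricLp_apply (t : unitInterval) (i : ℕ) :
    geometricLp t i = (1 - (t : ℝ) / 2) * ((t : ℝ) / 2) ^ i := rfl

theorem geometricLp_mem (t : unitInterval) : geometricLp t ∈ S := by
  have h₀ := t.2.1
  have h₁ := t.2.2
  refine ⟨fun i => ?_, hasSum_one_sub_mul_pow (by linarith) (by linarith)⟩
  rw [geometricLp_apply]
  exact mul_nonneg (by linarith) (by positivity)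

theorem continuous_geometricLp : Continuous geometricLp := by
  have h : geometricLp = fun t => ∑' i : ℕ, lp.single 1 i (geometricLp t i) :=
    funext fun t => (lp.hasSum_single ENNReal.one_ne_top (geometricLp t)).tsum_eq.symm
  rw [h]
  refine continuous_tsum (u := fun i : ℕ => (1 / 2 : ℝ) ^ i) (fun i => ?_)
    summable_geometric_two fun i t => ?_
  · refine (lp.isometry_single i).continuous.comp ?_
    simp only [geometricLp_apply]
    fun_prop
  · have h₀ := t.2.1
    have h₁ := t.2.2
    rw [lp.norm_single one_pos, geometricLp_apply, Real.norm_of_nonneg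
      (mul_nonneg (by linarith) (by positivity))]
    calc (1 - (t : ℝ) / 2) * ((t : ℝ) / 2) ^ i ≤ 1 * (1 / 2) ^ i := by
          gcongr; linarith
      _ = (1 / 2) ^ i := one_mul _

theorem measurableSet_BS [MeasurableSpace S] [BorelSpace S] (p : ℕ → ℝ) :
    MeasurableSet (BS p) := by
  have hc (i : ℕ) : Continuous fun q : S => q.1 i / p i :=
    (continuous_pi_iff.1 (lp.uniformContinuous_coe.continuous.comp continuous_subtype_val)
      i).div_const _
  have h : BS p = ⋂ (i : ℕ) (j : ℕ) (_ : i ≠ j), {q : S | q.1 i / p i = q.1 j / p j}ᶜ := by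
    ext q
    simp only [BS, Set.mem_ofPred_eq, Set.mem_iInter, Set.mem_compl_iff]
    exact ⟨fun h i j hij he => hij (h he), fun h i j he => by_contra fun hij => h i j hij he⟩
  rw [h]
  exact .iInter fun i => .iInter fun j => .iInter fun _ =>
    (isClosed_eq (hc i) (hc j)).measurableSet.compl

/-- Only countably many of the distributions `geometricLp t` lie outside `BS p`. -/
theorem countable_geometricLp_notMem_BS {p : ℕ → ℝ} (hp : ∀ i, 0 < p i) :
    {t | (⟨geometricLp t, geometricLp_mem t⟩ : S) ∉ BS p}.Countable := by
  have hsub : {t | (⟨geometricLp t, geometricLp_mem t⟩ : S) ∉ BS p} ⊆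
      {0} ∪ ⋃ (i : ℕ) (k : ℕ), {t | ((t : ℝ) / 2) ^ (k + 1) = p (i + k + 1) / p i} := by
    intro t ht
    rcases eq_or_ne t 0 with h0 | h0
    · exact .inl h0
    refine .inr ?_
    by_contra hn
    simp only [Set.mem_iUnion, Set.mem_ofPred_eq, not_exists] at hn
    refine ht (Function.Injective.of_lt_imp_ne fun i j hij he => ?_)
    obtain ⟨k, rfl⟩ := Nat.exists_eq_add_of_lt hij
    have ht₀ : 0 < (t : ℝ) := unitInterval.pos_iff_ne_zero.2 h0
    have ht₁ := t.2.2
    have hpi := hp i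
    have hpj := hp (i + k + 1)
    refine hn i k ?_
    simp only [geometricLp_apply] at he
    rw [div_eq_div_iff hpi.ne' hpj.ne'] at he
    rw [eq_div_iff hpi.ne']
    have hc : (1 - (t : ℝ) / 2) * ((t : ℝ) / 2) ^ i ≠ 0 :=
      mul_ne_zero (by linarith) (by positivity)
    refine mul_left_cancel₀ hc ?_
    rw [he, add_assoc, pow_add]
    ring
  refine Set.Countable.mono hsub ((Set.countable_singleton _).union ?_)
  refine Set.countable_iUnion fun i => Set.countable_iUnion fun k =>
    Set.Subsingleton.countable fun s hs t ht => ?_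
  have h := (pow_left_inj₀ (div_nonneg s.2.1 zero_le_two) (div_nonneg t.2.1 zero_le_two)
    k.succ_ne_zero).1 (hs.trans ht.symm)
  exact Subtype.ext (by linarith)

/-- There is a probability measure `M` on `S` (with the Borel σ-algebra
of the ℓ¹-subspace topology) such that for every nonempty countable family `P` of
probability distributions on `ℕ`, each with all components positive, the set
`BS(P) = ⋂_{p ∈ P} BS(p)` has `M`-measure `1`. -/
theorem exists_measure_bayes_blind_spot_inter_full :
    ∃ M : @Measure ↥S (borel ↥S),
      @IsProbabilityMeasure ↥S (borel ↥S) M ∧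
        ∀ P : Set (ℕ → ℝ), P.Nonempty → P.Countable →
          (∀ p ∈ P, ∀ i, 0 < p i) → (∀ p ∈ P, HasSum p 1) →
          M (⋂ p ∈ P, BS p) = 1 := by
  let _ : MeasurableSpace S := borel S
  have : BorelSpace S := ⟨rfl⟩
  have hg : Measurable fun t => (⟨geometricLp t, geometricLp_mem t⟩ : S) :=
    (continuous_geometricLp.subtype_mk _).measurable
  have hM := Measure.isProbabilityMeasure_map (μ := (volume : Measure unitInterval)) hg.aemeasurable
  refine ⟨_, hM, fun P _ hP hpos _ => ?_⟩
  have hmeas : MeasurableSet (⋂ p ∈ P, BS p) := .biInter hP fun p _ => measurableSet_BS p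
  rw [← prob_compl_eq_zero_iff hmeas, Set.compl_iInter₂, measure_biUnion_null_iff hP]
  intro p hp
  rw [Measure.map_apply hg (measurableSet_BS p).compl]
  exact (countable_geometricLp_notMem_BS (hpos p hp)).measure_zero _
end
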